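/- Let C ⊆ ℝ^{n×r} be nonempty, let g : ℝ^{n×r} → ℝ be differentiable with L-Lipschitz gradient and bounded below on C, and let ρ be a constant with ρ > L and (ρ − 3L)/2 − L²/ρ > 0. Let sequences (X^k)_{k≥0} in ℝ^{n×r}, (Y^k)_{k≥0} in C, and (U^k)_{k≥0} in ℝ^{n×r} satisfy, for all k ≥ 0: (i) Y^{k+1} ∈ C and ‖X^k − Y^{k+1} + U^k/ρ‖_F ≤ ‖X^k − Y + U^k/ρ‖_F for all Y ∈ C; (ii) ∇g(X^{k+1}) + U^k + ρ(X^{k+1} − Y^{k+1}) = 0; (iii) U^{k+1} = U^k + ρ(X^{k+1} − Y^{k+1}). Define L^k = g(X^k) + ⟨U^k, X^k − Y^k⟩ + (ρ/2)‖X^k − Y^k‖_F². Then the sequence (L^k) converges, and ‖X^{k+1} − X^k‖_F → 0, ‖U^{k+1} − U^k‖_F → 0, and ‖X^k − Y^k‖_F → 0 as k → ∞. -/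

import Mathlib

open Matrix BigOperators

attribute [local instance] Matrix.frobeniusNormedAddCommGroup Matrix.frobeniusNormedSpace

/-- Frobenius inner product `⟨A, B⟩ = Tr(AᵀB) = ∑ᵢⱼ Aᵢⱼ Bᵢⱼ`. -/
def finner {n r : ℕ} (A B : Matrix (Fin n) (Fin r) ℝ) : ℝ := ∑ i, ∑ j, A i j * B i j

/-- Frobenius norm of a real matrix. -/
noncomputable def fnorm {n r : ℕ} (A : Matrix (Fin n) (Fin r) ℝ) : ℝ :=
  Real.sqrt (∑ i, ∑ j, (A i j) ^ 2)

/-- The pairing `H ↦ ⟨G, H⟩` with a fixed matrix `G`, as a continuous linear map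
(with respect to the Frobenius norm). -/
noncomputable def pairCLM {n r : ℕ} (G : Matrix (Fin n) (Fin r) ℝ) :
    Matrix (Fin n) (Fin r) ℝ →L[ℝ] ℝ :=
  LinearMap.toContinuousLinearMap
    { toFun := fun H => finner G H
      map_add' := by
        intro H₁ H₂
        simp [finner, mul_add, Finset.sum_add_distrib]
      map_smul' := by
        intro c H
        simp [finner, Finset.mul_sum, mul_left_comm] }

section Frobenius

variable {n r : ℕ}

lemma finner_comm (A B : Matrix (Fin n) (Fin r) ℝ) : finner A B = finner B A := by
  simp only [finner, mul_comm]

lemma finner_add_right (A B D : Matrix (Fin n) (Fin r) ℝ) :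
    finner A (B + D) = finner A B + finner A D := by
  simp [finner, mul_add, Finset.sum_add_distrib]

lemma finner_smul_right (c : ℝ) (A B : Matrix (Fin n) (Fin r) ℝ) :
    finner A (c • B) = c * finner A B := by
  simp [finner, Finset.mul_sum, mul_left_comm]

lemma finner_add_left (A B D : Matrix (Fin n) (Fin r) ℝ) :
    finner (A + B) D = finner A D + finner B D := by
  simp only [finner_comm _ D, finner_add_right]

lemma finner_smul_left (c : ℝ) (A B : Matrix (Fin n) (Fin r) ℝ) :
    finner (c • A) B = c * finner A B := by
  simp only [finner_comm _ B, finner_smul_right]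

lemma finner_neg_right (A B : Matrix (Fin n) (Fin r) ℝ) : finner A (-B) = -finner A B := by
  simp [finner]

lemma finner_neg_left (A B : Matrix (Fin n) (Fin r) ℝ) : finner (-A) B = -finner A B := by
  simp [finner]

lemma fnorm_nonneg (A : Matrix (Fin n) (Fin r) ℝ) : 0 ≤ fnorm A := Real.sqrt_nonneg _

lemma fnorm_sq (A : Matrix (Fin n) (Fin r) ℝ) : fnorm A ^ 2 = finner A A := by
  rw [fnorm, Real.sq_sqrt (by positivity)]
  simp only [finner, sq]

lemma fnorm_smul (c : ℝ) (A : Matrix (Fin n) (Fin r) ℝ) : fnorm (c • A) = |c| * fnorm A := by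
  rw [← sq_eq_sq₀ (fnorm_nonneg _) (mul_nonneg (abs_nonneg _) (fnorm_nonneg _)), mul_pow, sq_abs,
    fnorm_sq, fnorm_sq, finner_smul_left, finner_smul_right]
  ring

lemma fnorm_neg (A : Matrix (Fin n) (Fin r) ℝ) : fnorm (-A) = fnorm A := by
  simp [fnorm]

lemma fnorm_sub_rev (A B : Matrix (Fin n) (Fin r) ℝ) : fnorm (A - B) = fnorm (B - A) := by
  rw [← fnorm_neg, neg_sub]

lemma fnorm_of_subsingleton [Subsingleton (Matrix (Fin n) (Fin r) ℝ)]
    (A : Matrix (Fin n) (Fin r) ℝ) : fnorm A = 0 := by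
  rw [Subsingleton.elim A 0]
  simp [fnorm]

lemma fnorm_pos {A : Matrix (Fin n) (Fin r) ℝ} (hA : A ≠ 0) : 0 < fnorm A := by
  refine Real.sqrt_pos.2 (lt_of_le_of_ne (by positivity) fun h => hA ?_)
  ext i j
  have h₁ := (Finset.sum_eq_zero_iff_of_nonneg fun i _ => by positivity).1 h.symm i
    (Finset.mem_univ i)
  have h₂ := (Finset.sum_eq_zero_iff_of_nonneg fun j _ => by positivity).1 h₁ j
    (Finset.mem_univ j)
  simpa using h₂

/-- The Cauchy–Schwarz inequality for the Frobenius inner product. -/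
lemma abs_finner_le (A B : Matrix (Fin n) (Fin r) ℝ) : |finner A B| ≤ fnorm A * fnorm B := by
  refine abs_le_of_sq_le_sq ?_ (mul_nonneg (fnorm_nonneg _) (fnorm_nonneg _))
  rw [mul_pow, fnorm, fnorm, Real.sq_sqrt (by positivity), Real.sq_sqrt (by positivity), finner]
  simp only [← Fintype.sum_prod_type']
  exact Finset.sum_mul_sq_le_sq_mul_sq _ _ _

/-- The descent lemma: a function with `L`-Lipschitz gradient is within `L / 2 * ‖B - A‖ ^ 2` of
its first-order expansion. -/
lemma abs_sub_linearization_le {L : ℝ} {g : Matrix (Fin n) (Fin r) ℝ → ℝ}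
    {gradg : Matrix (Fin n) (Fin r) ℝ → Matrix (Fin n) (Fin r) ℝ}
    (hdiff : ∀ A, HasFDerivAt g (pairCLM (gradg A)) A)
    (hLip : ∀ A B, fnorm (gradg A - gradg B) ≤ L * fnorm (A - B))
    (A D : Matrix (Fin n) (Fin r) ℝ) :
    |g (A + D) - g A - finner (gradg A) D| ≤ L / 2 * fnorm D ^ 2 := by
  have hf : ∀ t : ℝ, HasDerivAt (fun t : ℝ => g (A + t • D) - g A - t * finner (gradg A) D)
      (finner (gradg (A + t • D) - gradg A) D) t := by
    intro t
    have hline : HasDerivAt (fun t : ℝ => A + t • D) D t :=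
      (((hasDerivAt_id t).smul_const D).const_add A).congr_deriv (one_smul ℝ D)
    have h := (((hdiff (A + t • D)).comp_hasDerivAt t hline).sub_const (g A)).sub
      ((hasDerivAt_id t).mul_const (finner (gradg A) D))
    refine h.congr_deriv ?_
    rw [sub_eq_add_neg (gradg _), finner_add_left, finner_neg_left, one_mul, ← sub_eq_add_neg]
    rfl
  have hB : ∀ t : ℝ, HasDerivAt (fun t : ℝ => L / 2 * fnorm D ^ 2 * t ^ 2)
      (L * t * fnorm D ^ 2) t := by
    intro t
    refine ((hasDerivAt_pow 2 t).const_mul (L / 2 * fnorm D ^ 2)).congr_deriv ?_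
    push_cast
    ring
  have h := image_norm_le_of_norm_deriv_right_le_deriv_boundary (a := 0) (b := 1)
    (fun t _ => (hf t).continuousAt.continuousWithinAt) (fun t _ => (hf t).hasDerivWithinAt)
    (by simp) hB (fun t ht => ?_) (Set.right_mem_Icc.2 zero_le_one)
  · simpa using h
  · calc ‖finner (gradg (A + t • D) - gradg A) D‖
        ≤ fnorm (gradg (A + t • D) - gradg A) * fnorm D := abs_finner_le _ _
      _ ≤ L * fnorm (A + t • D - A) * fnorm D := by
          gcongr
          · exact fnorm_nonneg _
          · exact hLip _ _
      _ = L * t * fnorm D ^ 2 := by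
          rw [add_sub_cancel_left, fnorm_smul, abs_of_nonneg ht.1]
          ring

/-- Completing the square in the augmented Lagrangian. -/
lemma finner_add_half_mul_fnorm_sq {ρ : ℝ} (hρ : 0 < ρ) (U Z : Matrix (Fin n) (Fin r) ℝ) :
    finner U Z + ρ / 2 * fnorm Z ^ 2 =
      ρ / 2 * fnorm (Z + (1 / ρ) • U) ^ 2 - 1 / (2 * ρ) * fnorm U ^ 2 := by
  simp only [fnorm_sq, finner_add_left, finner_add_right, finner_smul_left, finner_smul_right,
    finner_comm Z U]
  field_simp
  ring

end Frobenius

/-- Convergence of ADMM for minimizing `g(X)` subject to `X = Y ∈ C`: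
the augmented Lagrangian values converge and the successive differences vanish. -/
theorem admm_convergence_lipschitz {n r : ℕ}
    (C : Set (Matrix (Fin n) (Fin r) ℝ)) (hCne : C.Nonempty) (L : ℝ)
    (g : Matrix (Fin n) (Fin r) ℝ → ℝ)
    (gradg : Matrix (Fin n) (Fin r) ℝ → Matrix (Fin n) (Fin r) ℝ)
    (hdiff : ∀ A, HasFDerivAt g (pairCLM (gradg A)) A)
    (hLip : ∀ A B, fnorm (gradg A - gradg B) ≤ L * fnorm (A - B))
    (hbdd : BddBelow (g '' C))
    (ρ : ℝ) (hρL : ρ > L) (hρ : (ρ - 3 * L) / 2 - L ^ 2 / ρ > 0)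
    (X Y U : ℕ → Matrix (Fin n) (Fin r) ℝ)
    (hYC : ∀ k, Y k ∈ C)
    (hYupd : ∀ k, ∀ W ∈ C,
      fnorm (X k - Y (k + 1) + (1 / ρ) • U k) ≤ fnorm (X k - W + (1 / ρ) • U k))
    (hXupd : ∀ k, gradg (X (k + 1)) + U k + ρ • (X (k + 1) - Y (k + 1)) = 0)
    (hUupd : ∀ k, U (k + 1) = U k + ρ • (X (k + 1) - Y (k + 1)))
    (𝓛 : ℕ → ℝ)
    (h𝓛 : ∀ k, 𝓛 k = g (X k) + finner (U k) (X k - Y k) + ρ / 2 * fnorm (X k - Y k) ^ 2) :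
    (∃ l : ℝ, Filter.Tendsto 𝓛 Filter.atTop (nhds l)) ∧
      Filter.Tendsto (fun k => fnorm (X (k + 1) - X k)) Filter.atTop (nhds 0) ∧
      Filter.Tendsto (fun k => fnorm (U (k + 1) - U k)) Filter.atTop (nhds 0) ∧
      Filter.Tendsto (fun k => fnorm (X k - Y k)) Filter.atTop (nhds 0) := by
  rcases subsingleton_or_nontrivial (Matrix (Fin n) (Fin r) ℝ) with hs | hs
  · have h𝓛const : 𝓛 = fun _ => 𝓛 0 := by
      funext k
      rw [h𝓛 k, h𝓛 0, Subsingleton.elim (X k) (X 0), Subsingleton.elim (Y k) (Y 0),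
        Subsingleton.elim (U k) (U 0)]
    refine ⟨⟨𝓛 0, ?_⟩, ?_, ?_, ?_⟩
    · rw [h𝓛const]
      exact tendsto_const_nhds
    all_goals simp [fnorm_of_subsingleton]
  have hL : 0 ≤ L := by
    obtain ⟨A, hA⟩ := exists_ne (0 : Matrix (Fin n) (Fin r) ℝ)
    have h := (fnorm_nonneg _).trans (hLip A 0)
    rw [sub_zero] at h
    exact nonneg_of_mul_nonneg_left h (fnorm_pos hA)
  have hρ0 : 0 < ρ := hL.trans_lt hρL
  have hUgrad : ∀ k, U (k + 1) = -gradg (X (k + 1)) := by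
    intro k
    rw [hUupd k, eq_neg_iff_add_eq_zero, ← hXupd k]
    abel
  have hΔU : ∀ k, fnorm (U (k + 2) - U (k + 1)) ≤ L * fnorm (X (k + 2) - X (k + 1)) := by
    intro k
    rw [hUgrad (k + 1), hUgrad k, neg_sub_neg, fnorm_sub_rev]
    exact hLip _ _
  have hΔUeq : ∀ k, fnorm (U (k + 1) - U k) = ρ * fnorm (X (k + 1) - Y (k + 1)) := by
    intro k
    rw [hUupd k, add_sub_cancel_left, fnorm_smul, abs_of_pos hρ0]
  set c := (ρ - L) / 2 - L ^ 2 / ρ with hc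
  have hc0 : 0 < c := by linarith
  have hdec : ∀ k, c * fnorm (X (k + 2) - X (k + 1)) ^ 2 ≤ 𝓛 (k + 1) - 𝓛 (k + 2) := by
    intro k
    obtain ⟨W, hW⟩ : ∃ W, W = X (k + 2) - Y (k + 2) := ⟨_, rfl⟩
    obtain ⟨D, hD⟩ : ∃ D, D = X (k + 1) - X (k + 2) := ⟨_, rfl⟩
    have hU2 : U (k + 2) = U (k + 1) + ρ • W := by rw [hW, hUupd (k + 1)]
    have hgrad : gradg (X (k + 2)) = -(U (k + 1) + ρ • W) := by
      rw [← hU2, hUgrad (k + 1), neg_neg]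
    have hWD : X (k + 1) - Y (k + 2) = W + D := by rw [hW, hD]; abel
    have hDn : fnorm (X (k + 2) - X (k + 1)) = fnorm D := by rw [fnorm_sub_rev, hD]
    have hY : g (X (k + 1)) + finner (U (k + 1)) (W + D) + ρ / 2 * fnorm (W + D) ^ 2
        ≤ 𝓛 (k + 1) := by
      have h := hYupd (k + 1) (Y (k + 1)) (hYC (k + 1))
      rw [hWD] at h
      have h' := mul_le_mul_of_nonneg_left (pow_le_pow_left₀ (fnorm_nonneg _) h 2)
        (half_pos hρ0).le
      rw [h𝓛 (k + 1), add_assoc, add_assoc, finner_add_half_mul_fnorm_sq hρ0,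
        finner_add_half_mul_fnorm_sq hρ0]
      linarith
    have hX := (abs_le.1 (abs_sub_linearization_le hdiff hLip (X (k + 2)) D)).1
    have hXD : X (k + 2) + D = X (k + 1) := by rw [hD]; abel
    rw [hXD, hgrad] at hX
    have hdual : ρ * fnorm W ^ 2 ≤ L ^ 2 / ρ * fnorm D ^ 2 := by
      have h := hΔU k
      rw [hΔUeq (k + 1), hDn, ← hW] at h
      have h' := pow_le_pow_left₀ (mul_nonneg hρ0.le (fnorm_nonneg _)) h 2
      rw [div_mul_eq_mul_div, le_div_iff₀ hρ0]
      linarith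
    rw [hDn, h𝓛 (k + 2), ← hW, hU2, hc]
    simp only [fnorm_sq, finner_add_left, finner_add_right, finner_smul_left, finner_neg_left,
      finner_comm D W] at *
    linarith
  obtain ⟨b, hb⟩ := hbdd
  have hlow : ∀ k, b ≤ 𝓛 (k + 1) := by
    intro k
    have h := (abs_le.1 (abs_sub_linearization_le hdiff hLip (X (k + 1))
      (-(X (k + 1) - Y (k + 1))))).2
    have hXY : X (k + 1) + -(X (k + 1) - Y (k + 1)) = Y (k + 1) := by abel
    have hbY := hb (Set.mem_image_of_mem g (hYC (k + 1)))
    rw [hXY, finner_neg_right, fnorm_neg] at h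
    rw [h𝓛 (k + 1), hUgrad k, finner_neg_left]
    nlinarith [mul_nonneg (sub_nonneg.2 hρL.le) (sq_nonneg (fnorm (X (k + 1) - Y (k + 1))))]
  have hanti : Antitone fun k => 𝓛 (k + 1) := antitone_nat_of_succ_le fun k => by
    have := hdec k
    have := mul_nonneg hc0.le (sq_nonneg (fnorm (X (k + 2) - X (k + 1))))
    linarith
  have hlim := tendsto_atTop_ciInf hanti ⟨b, Set.forall_mem_range.2 hlow⟩
  have hgap : Filter.Tendsto (fun k => (𝓛 (k + 1) - 𝓛 (k + 2)) / c) Filter.atTop (nhds 0) := by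
    simpa using (hlim.sub (hlim.comp (Filter.tendsto_add_atTop_nat 1))).div_const c
  have hX' : Filter.Tendsto (fun k => fnorm (X (k + 2) - X (k + 1))) Filter.atTop (nhds 0) := by
    refine squeeze_zero (fun _ => fnorm_nonneg _) (fun k => ?_) (by simpa using hgap.sqrt)
    refine Real.le_sqrt_of_sq_le ?_
    rw [le_div_iff₀ hc0, mul_comm]
    exact hdec k
  have hU' : Filter.Tendsto (fun k => fnorm (U (k + 2) - U (k + 1))) Filter.atTop (nhds 0) :=
    squeeze_zero (fun _ => fnorm_nonneg _) hΔU (by simpa using hX'.const_mul L)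
  refine ⟨⟨_, (Filter.tendsto_add_atTop_iff_nat 1).1 hlim⟩,
    (Filter.tendsto_add_atTop_iff_nat 1).1 hX', (Filter.tendsto_add_atTop_iff_nat 1).1 hU',
    (Filter.tendsto_add_atTop_iff_nat 2).1 ?_⟩
  have h := hU'.const_mul ρ⁻¹
  rw [mul_zero] at h
  refine h.congr fun k => ?_
  rw [hΔUeq (k + 1), inv_mul_cancel_left₀ hρ0.ne']
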